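/- Suppose h : ℝ → ℝ is smooth, nonnegative, compactly supported in (0,∞). Then ∑_{k ≥ 1} h(4k/K)·log k = (K/4)(log K - log 4)·∫₀^∞ h(y)dy + (K/4)·∫₀^∞ h(y) log y dy + O_b(K^{-b}) for every b > 0 as K → ∞. -/

import Mathlib

open Real MeasureTheory
open scoped SchwartzMap FourierTransform ContDiff

/-- The derivative of a smooth function vanishing on `(-∞, 0]` vanishes on `(-∞, 0]`. -/
theorem deriv_eq_zero_of_forall_nonpos {g : ℝ → ℝ} (hg : ContDiff ℝ ∞ g)
    (hg0 : ∀ x ≤ 0, g x = 0) : ∀ x ≤ 0, deriv g x = 0 := by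
  have hc : Continuous (deriv g) := (contDiff_infty_iff_deriv.1 hg).2.continuous
  have hsub : Set.Iio (0 : ℝ) ⊆ {x | deriv g x = 0} := by
    intro x hx
    have he : g =ᶠ[nhds x] fun _ => (0 : ℝ) := by
      filter_upwards [Iio_mem_nhds (Set.mem_Iio.1 hx)] with y hy
      exact hg0 y (le_of_lt hy)
    simpa using he.deriv_eq
  have hcl := closure_minimal hsub (isClosed_eq hc continuous_const)
  rw [closure_Iio] at hcl
  exact fun x hx => hcl hx

/-- A smooth function vanishing on `(-∞, 0]` vanishes to every order at `0`. -/
theorem exists_abs_le_mul_abs_pow_of_forall_nonpos (m : ℕ) : ∀ {g : ℝ → ℝ}, ContDiff ℝ ∞ g →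
    (∀ x ≤ 0, g x = 0) → ∃ C, 0 ≤ C ∧ ∀ x ≤ 1, |g x| ≤ C * |x| ^ m := by
  induction m with
  | zero =>
    intro g hg hg0
    obtain ⟨C, hC⟩ := isCompact_Icc.exists_bound_of_continuousOn
      (s := Set.Icc (0 : ℝ) 1) hg.continuous.continuousOn
    have hC0 : 0 ≤ C := (norm_nonneg _).trans (hC 0 (by simp))
    refine ⟨C, hC0, fun x hx => ?_⟩
    rcases le_total x 0 with h | h
    · simpa [hg0 x h] using hC0
    · simpa using hC x ⟨h, hx⟩
  | succ m ih =>
    intro g hg hg0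
    obtain ⟨C, hC0, hC⟩ := ih (contDiff_infty_iff_deriv.1 hg).2
      (deriv_eq_zero_of_forall_nonpos hg hg0)
    refine ⟨C, hC0, fun x hx => ?_⟩
    rcases le_total x 0 with h | h
    · rw [hg0 x h, abs_zero]; positivity
    · have key := Convex.norm_image_sub_le_of_norm_deriv_le (f := g) (s := Set.Icc 0 x)
        (x := 0) (y := x) (C := C * |x| ^ m)
        (fun y _ => (contDiff_infty_iff_deriv.1 hg).1 y)
        (fun y hy => (hC y (hy.2.trans hx)).trans (by
          gcongr 2
          exact abs_le_abs_of_nonneg hy.1 hy.2))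
        (convex_Icc 0 x) ⟨le_rfl, h⟩ ⟨h, le_rfl⟩
      rw [hg0 0 le_rfl, sub_zero, sub_zero, Real.norm_eq_abs, Real.norm_eq_abs] at key
      rw [pow_succ, ← mul_assoc]
      exact key

theorem hasDerivAt_mul_inv_pow_mul_log_pow {g : ℝ → ℝ} (hg : ContDiff ℝ ∞ g)
    (hg0 : ∀ x ≤ 0, g x = 0) (k j : ℕ) (x : ℝ) :
    HasDerivAt (fun x => g x * x⁻¹ ^ k * log x ^ j)
      (deriv g x * x⁻¹ ^ k * log x ^ j - k * (g x * x⁻¹ ^ (k + 1) * log x ^ j)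
        + j * (g x * x⁻¹ ^ (k + 1) * log x ^ (j - 1))) x := by
  rcases eq_or_ne x 0 with rfl | hx
  · rw [hg0 0 le_rfl, deriv_eq_zero_of_forall_nonpos hg hg0 0 le_rfl]
    simp only [zero_mul, mul_zero, sub_zero, add_zero]
    obtain ⟨C, hC0, hC⟩ := exists_abs_le_mul_abs_pow_of_forall_nonpos (k + j + 2) hg hg0
    have hbound : ∀ x ≤ 1, |g x * x⁻¹ ^ k * log x ^ j| ≤ C * |x| ^ 2 := by
      intro x hx1
      rcases le_or_gt x 0 with h | h
      · rw [hg0 x h]; simp only [zero_mul, abs_zero]; positivity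
      · have hlog : |log x| ≤ x⁻¹ := by
          have := abs_log_mul_self_lt x h hx1
          rw [abs_mul, abs_of_pos h] at this
          rw [inv_eq_one_div, le_div_iff₀ h]
          exact this.le
        have h1 := hC x hx1
        rw [abs_of_pos h] at h1 ⊢
        rw [abs_mul, abs_mul, abs_pow, abs_pow, abs_of_pos (inv_pos.2 h)]
        calc |g x| * x⁻¹ ^ k * |log x| ^ j
            ≤ (C * x ^ (k + j + 2)) * x⁻¹ ^ k * x⁻¹ ^ j := by gcongr
          _ = C * x ^ 2 * (x * x⁻¹) ^ k * (x * x⁻¹) ^ j := by ring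
          _ = C * x ^ 2 := by rw [mul_inv_cancel₀ h.ne']; simp
    have hO : (fun x => g x * x⁻¹ ^ k * log x ^ j) =O[nhds 0] fun x : ℝ => ‖x - 0‖ ^ 2 := by
      refine Asymptotics.IsBigO.of_bound C ?_
      filter_upwards [Iic_mem_nhds (zero_lt_one' ℝ)] with x hx1
      simpa using hbound x hx1
    simpa using (hO.hasFDerivAt (𝕜 := ℝ) one_lt_two).hasDerivAt
  · have h1 := ((contDiff_infty_iff_deriv.1 hg).1 x).hasDerivAt
    have h2 := (hasDerivAt_inv hx).fun_pow k
    have h3 := (hasDerivAt_log hx).fun_pow j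
    refine ((h1.fun_mul h2).fun_mul h3).congr_deriv ?_
    rcases k with _ | k
    · simp; ring
    · simp only [Nat.add_sub_cancel]
      push_cast
      rw [← inv_pow]
      ring

/-- Multiplying a smooth function vanishing on `(-∞, 0]` by powers of `x⁻¹` and `log x` keeps it
smooth. -/
theorem contDiff_mul_inv_pow_mul_log_pow (n : ℕ) : ∀ {g : ℝ → ℝ}, ContDiff ℝ ∞ g →
    (∀ x ≤ 0, g x = 0) → ∀ k j : ℕ, ContDiff ℝ n fun x => g x * x⁻¹ ^ k * log x ^ j := by
  induction n with
  | zero =>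
    intro g hg hg0 k j
    exact contDiff_zero.2 (continuous_iff_continuousAt.2 fun x =>
      (hasDerivAt_mul_inv_pow_mul_log_pow hg hg0 k j x).continuousAt)
  | succ n ih =>
    intro g hg hg0 k j
    have hd := hasDerivAt_mul_inv_pow_mul_log_pow hg hg0 k j
    push_cast
    refine contDiff_succ_iff_deriv.2 ⟨fun x => (hd x).differentiableAt, by simp, ?_⟩
    rw [funext fun x => (hd x).deriv]
    exact ((ih (contDiff_infty_iff_deriv.1 hg).2 (deriv_eq_zero_of_forall_nonpos hg hg0) k j).sub
      (contDiff_const.mul (ih hg hg0 (k + 1) j))).add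
      (contDiff_const.mul (ih hg hg0 (k + 1) (j - 1)))

theorem contDiff_mul_log {g : ℝ → ℝ} (hg : ContDiff ℝ ∞ g) (hg0 : ∀ x ≤ 0, g x = 0) :
    ContDiff ℝ ∞ fun x => g x * log x :=
  contDiff_infty.2 fun n => by simpa using contDiff_mul_inv_pow_mul_log_pow n hg hg0 0 1

theorem Real.fourier_comp_div {f : ℝ → ℂ} {T : ℝ} (hT : 0 < T) (w : ℝ) :
    𝓕 (fun x => f (x / T)) w = T * 𝓕 f (T * w) := by
  rw [Real.fourier_real_eq, Real.fourier_real_eq]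
  have := Measure.integral_comp_div (fun v => 𝐞 (-(v * (T * w))) • f v) T
  rw [abs_of_pos hT, Complex.real_smul] at this
  rw [← this]
  congr 1 with v
  rw [show v / T * (T * w) = v * w by field_simp]

/-- Riemann sums of a Schwartz function approximate its integral to any power of the mesh. -/
theorem SchwartzMap.exists_norm_tsum_sub_integral_le (f : 𝓢(ℝ, ℂ)) (n : ℕ) :
    ∃ C, 0 ≤ C ∧ ∀ T : ℝ, 0 < T →
      ‖∑' k : ℤ, f (k / T) - T * ∫ x, f x‖ ≤ C * (T⁻¹) ^ (n + 1) := by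
  obtain ⟨D, hD0, hD⟩ := (𝓕 f).decay (n + 2) 0
  have hsum : Summable fun k : ℤ => |1 / (k : ℝ) ^ (n + 2)| :=
    (Real.summable_one_div_int_pow.2 (by lia)).abs
  refine ⟨D * ∑' k : ℤ, |1 / (k : ℝ) ^ (n + 2)|, by positivity, fun T hT => ?_⟩
  let e : ℝ ≃L[ℝ] ℝ := ContinuousLinearEquiv.unitsEquivAut ℝ (Units.mk0 T⁻¹ (inv_ne_zero hT.ne'))
  let F : 𝓢(ℝ, ℂ) := SchwartzMap.compCLMOfContinuousLinearEquiv ℂ e f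
  have hF : ⇑F = fun x => f (x / T) := by
    ext x
    simp [F, e, div_eq_mul_inv]
  have hFhat : ∀ w : ℝ, 𝓕 F w = T * 𝓕 f (T * w) := by
    intro w
    rw [SchwartzMap.fourier_coe, hF, Real.fourier_comp_div hT, SchwartzMap.fourier_coe]
  have hzero : 𝓕 f 0 = ∫ x, f x := by
    rw [SchwartzMap.fourier_coe, Real.fourier_real_eq]
    simp
  have hP := F.tsum_eq_tsum_fourier 0
  simp only [zero_add, QuotientAddGroup.mk_zero, fourier_eval_zero, mul_one, hF, hFhat] at hP
  have hterm : ∀ k : ℤ, ‖if k = 0 then 0 else (T : ℂ) * 𝓕 f (T * k)‖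
      ≤ D * (T⁻¹) ^ (n + 1) * |1 / (k : ℝ) ^ (n + 2)| := by
    intro k
    split_ifs with hk
    · simp only [norm_zero]; positivity
    · have hk' : 0 < |(k : ℝ)| := abs_pos.2 (by exact_mod_cast hk)
      have := hD (T * k)
      rw [norm_iteratedFDeriv_zero, Real.norm_eq_abs, abs_mul, abs_of_pos hT] at this
      rw [norm_mul, Complex.norm_real, Real.norm_eq_abs, abs_of_pos hT, abs_div, abs_one, abs_pow]
      rw [mul_comm, ← le_div_iff₀ (by positivity)] at this
      calc T * ‖𝓕 f (T * k)‖ ≤ T * (D / (T * |(k : ℝ)|) ^ (n + 2)) := by gcongr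
        _ = (T * T⁻¹) * (D * T⁻¹ ^ (n + 1) * (1 / |(k : ℝ)| ^ (n + 2))) := by
          rw [div_eq_mul_inv D, ← inv_pow, mul_inv, one_div, ← inv_pow]; ring
        _ = _ := by rw [mul_inv_cancel₀ hT.ne', one_mul]
  have hS := hsum.mul_left (D * (T⁻¹) ^ (n + 1))
  have hsummable : Summable fun k : ℤ => (T : ℂ) * 𝓕 f (T * k) := by
    refine (Summable.of_norm_bounded hS hterm).congr_cofinite ?_
    filter_upwards [(Set.finite_singleton (0 : ℤ)).compl_mem_cofinite] with k hk
    rw [if_neg (by simpa using hk)]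
  rw [hP, hsummable.tsum_eq_add_tsum_ite 0]
  simp only [Int.cast_zero, mul_zero, hzero, add_sub_cancel_left]
  refine (tsum_of_norm_bounded hS.hasSum hterm).trans (le_of_eq ?_)
  rw [tsum_mul_left]
  ring

theorem summable_pnat_comp_div {f : ℝ → ℝ} (hf : HasCompactSupport f) {T : ℝ} (hT : 0 < T) :
    Summable fun k : ℕ+ => f (k / T) := by
  obtain ⟨R, hR⟩ := hf.isBounded.subset_closedBall 0
  refine summable_of_hasFiniteSupport ((Set.finite_Iic (⌊R * T⌋₊.succPNat)).subset fun k hk => ?_)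
  have h1 := hR (subset_tsupport f hk)
  rw [mem_closedBall_zero_iff, Real.norm_eq_abs, abs_of_nonneg (by positivity),
    div_le_iff₀ hT] at h1
  have h2 : (k : ℕ) ≤ ⌊R * T⌋₊ := Nat.le_floor h1
  rw [Set.mem_Iic, ← PNat.coe_le_coe, Nat.succPNat_coe]
  lia

/-- Riemann sums over the positive integers of a smooth compactly supported function vanishing on
`(-∞, 0]` approximate its integral to any power of the mesh. -/
theorem exists_abs_tsum_pnat_sub_integral_le {f : ℝ → ℝ} (hf : ContDiff ℝ ∞ f)
    (hfc : HasCompactSupport f) (hf0 : ∀ x ≤ 0, f x = 0) (n : ℕ) :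
    ∃ C, 0 ≤ C ∧ ∀ T : ℝ, 0 < T →
      |∑' k : ℕ+, f (k / T) - T * ∫ x in Set.Ioi (0 : ℝ), f x| ≤ C * (T⁻¹) ^ (n + 1) := by
  have hc : HasCompactSupport fun x => (f x : ℂ) := hfc.comp_left (g := Complex.ofReal) rfl
  obtain ⟨C, hC0, hC⟩ := (hc.toSchwartzMap
    (Complex.ofRealCLM.contDiff.comp hf)).exists_norm_tsum_sub_integral_le n
  refine ⟨C, hC0, fun T hT => ?_⟩
  have hint : ∫ x in Set.Ioi (0 : ℝ), f x = ∫ x, f x :=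
    setIntegral_eq_integral_of_forall_compl_eq_zero fun x hx => hf0 x (not_lt.1 hx)
  have hinj : Function.Injective fun k : ℕ+ => ((k : ℕ) : ℤ) := fun a b hab => by simpa using hab
  have hsum : ∑' k : ℕ+, f (k / T) = ∑' k : ℤ, f (k / T) := by
    refine hinj.tsum_eq (f := fun k : ℤ => f (k / T)) fun k hk => ?_
    have hk0 : 0 < k := by
      by_contra hneg
      refine hk (hf0 _ (div_nonpos_of_nonpos_of_nonneg ?_ hT.le))
      exact_mod_cast not_lt.1 hneg
    exact ⟨⟨k.toNat, by lia⟩, by simp [hk0.le]⟩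
  have := hC T hT
  change ‖∑' k : ℤ, (f (k / T) : ℂ) - T * ∫ x, (f x : ℂ)‖ ≤ _ at this
  rw [integral_complex_ofReal, ← Complex.ofReal_tsum] at this
  rw [hint, hsum]
  rw [← Complex.ofReal_mul, ← Complex.ofReal_sub, Complex.norm_real] at this
  exact this

theorem stmt10 (h : ℝ → ℝ) (hsmooth : ContDiff ℝ (⊤ : ℕ∞) h) (hpos : ∀ x, 0 ≤ h x)
    (hsupp : HasCompactSupport h) (hsupp' : Function.support h ⊆ Set.Ioi (0 : ℝ)) :
    ∀ b : ℝ, 0 < b → ∃ C : ℝ, ∀ K : ℝ, 2 ≤ K →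
      |(∑' k : ℕ+, h (4 * (k : ℝ) / K) * Real.log k)
          - ((K / 4) * (Real.log K - Real.log 4) * ∫ y in Set.Ioi (0 : ℝ), h y)
          - (K / 4) * ∫ y in Set.Ioi (0 : ℝ), h y * Real.log y|
        ≤ C * K ^ (-b) := by
  intro b hb
  have h0 : ∀ x ≤ 0, h x = 0 := fun x hx => by
    by_contra hne
    exact absurd (hsupp' hne) (not_lt.2 hx)
  have hl0 : ∀ x ≤ 0, h x * log x = 0 := fun x hx => by rw [h0 x hx, zero_mul]
  have hlc : HasCompactSupport fun x => h x * log x := hsupp.mul_right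
  obtain ⟨A, hA0, hA⟩ := exists_abs_tsum_pnat_sub_integral_le hsmooth hsupp h0 ⌈b⌉₊
  obtain ⟨B, hB0, hB⟩ := exists_abs_tsum_pnat_sub_integral_le
    (contDiff_mul_log hsmooth h0) hlc hl0 ⌈b⌉₊
  refine ⟨(B + (1 + |log 4|) * A) * 4 ^ (⌈b⌉₊ + 1), fun K hK => ?_⟩
  have hK0 : 0 < K := by linarith
  have hT : 0 < K / 4 := by positivity
  have hsplit : ∑' k : ℕ+, h (4 * (k : ℝ) / K) * Real.log k
      = ∑' k : ℕ+, h (k / (K / 4)) * log (k / (K / 4))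
        + (log K - log 4) * ∑' k : ℕ+, h (k / (K / 4)) := by
    rw [← tsum_mul_left, ← (summable_pnat_comp_div hlc hT).tsum_add
      ((summable_pnat_comp_div hsupp hT).mul_left _)]
    refine tsum_congr fun k => ?_
    have hk : (k : ℝ) ≠ 0 := by exact_mod_cast k.ne_zero
    rw [log_div hk hT.ne', log_div hK0.ne' four_ne_zero,
      show 4 * (k : ℝ) / K = k / (K / 4) by field_simp]
    ring
  have hlogK : |log K - log 4| ≤ (1 + |log 4|) * K := by
    have h1 : |log K| ≤ K := by
      rw [abs_of_nonneg (log_nonneg (by linarith))]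
      exact (log_le_sub_one_of_pos hK0).trans (by linarith)
    calc |log K - log 4| ≤ |log K| + |log 4| := abs_sub _ _
      _ ≤ K + |log 4| * K := by
        gcongr
        exact le_mul_of_one_le_right (abs_nonneg _) (by linarith)
      _ = _ := by ring
  have hpow : K * K⁻¹ ^ (⌈b⌉₊ + 1) ≤ K ^ (-b) := by
    rw [pow_succ', ← mul_assoc, mul_inv_cancel₀ hK0.ne', one_mul, inv_pow, ← rpow_natCast,
      ← rpow_neg hK0.le]
    exact rpow_le_rpow_of_exponent_le (by linarith) (neg_le_neg (Nat.le_ceil b))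
  rw [hsplit]
  set S := ∑' k : ℕ+, h (k / (K / 4))
  set S' := ∑' k : ℕ+, h (k / (K / 4)) * log (k / (K / 4))
  set I := ∫ y in Set.Ioi (0 : ℝ), h y
  set I' := ∫ y in Set.Ioi (0 : ℝ), h y * log y
  have hinv : (K / 4)⁻¹ ^ (⌈b⌉₊ + 1) = 4 ^ (⌈b⌉₊ + 1) * K⁻¹ ^ (⌈b⌉₊ + 1) := by
    rw [← mul_pow, inv_div, div_eq_mul_inv]
  calc |S' + (log K - log 4) * S - K / 4 * (log K - log 4) * I - K / 4 * I'|
      = |(S' - K / 4 * I') + (log K - log 4) * (S - K / 4 * I)| := by ring_nf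
    _ ≤ |S' - K / 4 * I'| + |log K - log 4| * |S - K / 4 * I| := by
      rw [← abs_mul]; exact abs_add_le _ _
    _ ≤ B * (K / 4)⁻¹ ^ (⌈b⌉₊ + 1)
        + ((1 + |log 4|) * K) * (A * (K / 4)⁻¹ ^ (⌈b⌉₊ + 1)) := by
      gcongr
      · exact hB _ hT
      · exact hA _ hT
    _ ≤ (B * K) * (K / 4)⁻¹ ^ (⌈b⌉₊ + 1)
        + ((1 + |log 4|) * K) * (A * (K / 4)⁻¹ ^ (⌈b⌉₊ + 1)) := by
      gcongr
      exact le_mul_of_one_le_right hB0 (by linarith)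
    _ = (B + (1 + |log 4|) * A) * 4 ^ (⌈b⌉₊ + 1) * (K * K⁻¹ ^ (⌈b⌉₊ + 1)) := by
      rw [hinv]; ring
    _ ≤ _ := by gcongr
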